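/- Let op_0 op_1 ... op_n be a valid sequence of order-2 stack operations. Then for all 0 ≤ j ≤ n, Push2(j) = −1 if and only if for all 0 ≤ k ≤ j the factor op_k ... op_j does not belong to L2. -/

import Mathlib

/-- Order-2 stack operations over stack alphabet `S`. -/
inductive Op (S : Type) : Type where
  | push1 : S → Op S
  | pop1  : Op S
  | push2 : Op S
  | pop2  : Op S
  | collapse : Op S
  deriving DecidableEq

/-- Annotated stack symbol: (symbol, collapse link, position annotation). -/
abbrev ASym (S : Type) : Type := S × ℕ × ℤ
/-- Annotated order-1 stack, topmost symbol first. -/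
abbrev Stk1 (S : Type) : Type := List (ASym S)
/-- Annotated order-2 stack: list of (position annotation, order-1 stack), topmost first.
In `[[u_1][u_2] ⋯ [u_n]]` the topmost stack `u_n` comes first in the list. -/
abbrev Stk2 (S : Type) : Type := List (ℤ × Stk1 S)

/-- The initial order-2 stack `[[]]`, its unique (empty) order-1 stack annotated `-1`. -/
def initStk (S : Type) : Stk2 S := [(-1, ([] : Stk1 S))]

/-- One step of the annotated semantics; `p` is the current position.
`push1 s` records the collapse link `n-1` (number of stacks below the top) and the
position annotation `p`; `push2` duplicates the top stack annotating the copy with `p`;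
`collapse` keeps the bottom `i` order-1 stacks, where `i` is the collapse link of the
topmost symbol.  Undefined operations yield `none`. -/
def step {S : Type} (p : ℕ) (op : Op S) (W : Stk2 S) : Option (Stk2 S) :=
  match op, W with
  | .push2, t :: rest => some (((p : ℤ), t.2) :: t :: rest)
  | .pop2, _ :: t :: rest => some (t :: rest)
  | .push1 s, (a, u) :: rest => some ((a, (s, rest.length, (p : ℤ)) :: u) :: rest)
  | .pop1, (a, _ :: u) :: rest => some ((a, u) :: rest)
  | .collapse, (_, (_, i, _) :: _) :: _ =>
      if 1 ≤ i ∧ i < W.length then some (W.drop (W.length - i)) else none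
  | _, _ => none

def runFrom {S : Type} (p : ℕ) (W : Stk2 S) : List (Op S) → Option (Stk2 S)
  | [] => some W
  | op :: rest => (step p op W).bind fun W' => runFrom (p + 1) W' rest

/-- `stkAt ops j` is the annotated order-2 stack `W_j` after executing `op_0 ⋯ op_j`
(for `j = -1` this is the initial stack `[[]]`). -/
def stkAt {S : Type} (ops : List (Op S)) (j : ℤ) : Option (Stk2 S) :=
  runFrom 0 (initStk S) (ops.take (j + 1).toNat)

/-- A nonempty sequence of operations is valid if every operation is defined,
starting from the empty order-2 stack `[[]]`. -/
def Valid {S : Type} (ops : List (Op S)) : Prop :=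
  ops ≠ [] ∧ (runFrom 0 (initStk S) ops).isSome

/-- `push1At ops j` is `push1(j)`: the position annotation of the topmost symbol of the
topmost order-1 stack of `W_j`, or `-1` if that stack is empty (also `-1` for `j = -1`). -/
def push1At {S : Type} (ops : List (Op S)) (j : ℤ) : ℤ :=
  match stkAt ops j with
  | some ((_, (_, _, p) :: _) :: _) => p
  | _ => -1

/-- `Push2At ops j` is `Push2(j)`: the position annotation of the topmost order-1 stack
of `W_j` (`-1` for `j = -1`). -/
def Push2At {S : Type} (ops : List (Op S)) (j : ℤ) : ℤ :=
  match stkAt ops j with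
  | some ((a, _) :: _) => a
  | _ => -1

mutual
/-- Words derived from the nonterminal `S1` of the grammar
`S1 → ↑1 | S1 ↑2 | S1 S1 ↓1 | S1 S2 ↓2 | S1 S2 S1 ⇓`
(all letters `↑1(s)` are identified with the single letter `↑1`). -/
inductive InL1 {S : Type} : List (Op S) → Prop where
  | base (s : S) : InL1 [Op.push1 s]
  | push2 (w : List (Op S)) : InL1 w → InL1 (w ++ [Op.push2])
  | pop1 (v w : List (Op S)) : InL1 v → InL1 w → InL1 (v ++ w ++ [Op.pop1])
  | pop2 (v w : List (Op S)) : InL1 v → InL2 w → InL1 (v ++ w ++ [Op.pop2])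
  | collapse (v w x : List (Op S)) : InL1 v → InL2 w → InL1 x →
      InL1 (v ++ w ++ x ++ [Op.collapse])

/-- Words derived from the nonterminal `S2` of the grammar
`S2 → ↑2 | S2 ↑1 | S2 ↓1 | S2 S2 ↓2 | S2 S2 S1 ⇓`. -/
inductive InL2 {S : Type} : List (Op S) → Prop where
  | base : InL2 [Op.push2]
  | push1 (s : S) (w : List (Op S)) : InL2 w → InL2 (w ++ [Op.push1 s])
  | pop1 (w : List (Op S)) : InL2 w → InL2 (w ++ [Op.pop1])
  | pop2 (v w : List (Op S)) : InL2 v → InL2 w → InL2 (v ++ w ++ [Op.pop2])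
  | collapse (v w x : List (Op S)) : InL2 v → InL2 w → InL1 x →
      InL2 (v ++ w ++ x ++ [Op.collapse])
end

/-- The factor `op_i ⋯ op_j` of the sequence. -/
def factor {S : Type} (ops : List (Op S)) (i j : ℕ) : List (Op S) :=
  (ops.drop i).take (j + 1 - i)

/-- Stack before executing position `n`. -/
def stkBefore {S : Type} (ops : List (Op S)) (n : ℕ) : Option (Stk2 S) :=
  runFrom 0 (initStk S) (ops.take n)

/-- The factor at positions `k, ..., n-1`. -/
def seg {S : Type} (ops : List (Op S)) (k n : ℕ) : List (Op S) := (ops.take n).drop k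

theorem runFrom_append {S : Type} (l1 l2 : List (Op S)) : ∀ (p : ℕ) (W : Stk2 S),
    runFrom p W (l1 ++ l2) = (runFrom p W l1).bind fun W' => runFrom (p + l1.length) W' l2 := by
  induction l1 with
  | nil => intro p W; simp [runFrom]
  | cons a l ih =>
    intro p W
    simp only [List.cons_append, runFrom, List.length_cons]
    cases step p a W with
    | none => simp
    | some W' => simp [ih, Nat.add_assoc, Nat.add_comm 1]

theorem stkBefore_succ {S : Type} (ops : List (Op S)) (n : ℕ) (h : n < ops.length) :
    stkBefore ops (n + 1) = (stkBefore ops n).bind (step n ops[n]) := by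
  unfold stkBefore
  rw [List.take_succ_eq_append_getElem h, runFrom_append]
  congr 1
  funext W
  simp [runFrom, Nat.min_eq_left h.le]

theorem stkBefore_isSome {S : Type} (ops : List (Op S)) (hv : Valid ops) (n : ℕ) :
    ∃ W, stkBefore ops n = some W := by
  have h := hv.2
  rw [← List.take_append_drop n ops, runFrom_append] at h
  unfold stkBefore
  cases hc : runFrom 0 (initStk S) (ops.take n) with
  | none => simp [hc] at h
  | some W => exact ⟨W, rfl⟩

/-- The run invariant. -/
def Good {S : Type} (F : ℕ → Option (Stk2 S)) (n : ℕ) (W : Stk2 S) : Prop :=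
  ∀ q v B, (q, v) :: B <:+ W →
    ((B = [] ∧ q = -1) ∨ ∃ m : ℕ, q = m ∧ m < n ∧ F m = some B ∧ B ≠ []) ∧
    ∀ s i p u, (s, i, p) :: u <:+ v →
      ∃ (m : ℕ) (a : ℤ) (R : Stk2 S), p = m ∧ m < n ∧ F m = some ((a, u) :: R) ∧
        R.length = i ∧ R <:+ B

theorem Good.suffix {S : Type} {F : ℕ → Option (Stk2 S)} {n : ℕ} {W W' : Stk2 S}
    (h : Good F n W) (hs : W' <:+ W) : Good F n W' :=
  fun q v B hB => h q v B (hB.trans hs)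

theorem Good.mono {S : Type} {F : ℕ → Option (Stk2 S)} {n n' : ℕ} {W : Stk2 S}
    (h : Good F n W) (hn : n ≤ n') : Good F n' W := by
  intro q v B hB
  obtain ⟨h1, h2⟩ := h q v B hB
  refine ⟨?_, ?_⟩
  · rcases h1 with h1 | ⟨m, a, b, c⟩
    · exact Or.inl h1
    · exact Or.inr ⟨m, a, by omega, c⟩
  · intro s i p u hu
    obtain ⟨m, a, R, e1, e2, e3⟩ := h2 s i p u hu
    exact ⟨m, a, R, e1, by omega, e3⟩

theorem drop_of_suffix {α : Type} {R W : List α} (h : R <:+ W) :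
    W.drop (W.length - R.length) = R := (List.suffix_iff_eq_drop.1 h).symm

theorem Good.step {S : Type} {F : ℕ → Option (Stk2 S)} {n : ℕ} {op : Op S} {W W' : Stk2 S}
    (hF : F n = some W) (h : Good F n W) (hs : step n op W = some W') :
    Good F (n + 1) W' := by
  have hm := h.mono (Nat.le_succ n)
  match op, W with
  | .push2, [] => simp [_root_.step] at hs
  | .pop2, [] => simp [_root_.step] at hs
  | .pop1, [] => simp [_root_.step] at hs
  | .push1 _, [] => simp [_root_.step] at hs
  | .collapse, [] => simp [_root_.step] at hs
  | .pop2, [_] => simp [_root_.step] at hs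
  | .pop1, (_, []) :: _ => simp [_root_.step] at hs
  | .collapse, (_, []) :: _ => simp [_root_.step] at hs
  | .push2, (b, w) :: rest =>
    simp only [_root_.step, Option.some.injEq] at hs
    subst hs
    intro q v B hB
    rcases List.suffix_cons_iff.1 hB with e | hB
    · simp only [List.cons.injEq, Prod.mk.injEq] at e
      obtain ⟨⟨rfl, rfl⟩, rfl⟩ := e
      refine ⟨Or.inr ⟨n, rfl, by omega, hF, by simp⟩, ?_⟩
      intro s i p u hu
      obtain ⟨m, a, R, e1, e2, e3, e4, e5⟩ := (hm _ _ _ List.suffix_rfl).2 s i p u hu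
      exact ⟨m, a, R, e1, e2, e3, e4, e5.trans (List.suffix_cons _ _)⟩
    · exact hm _ _ _ hB
  | .pop2, _ :: t :: rest =>
    simp only [_root_.step, Option.some.injEq] at hs
    subst hs
    exact hm.suffix (List.suffix_cons _ _)
  | .push1 s, (b, w) :: rest =>
    simp only [_root_.step, Option.some.injEq] at hs
    subst hs
    intro q v B hB
    rcases List.suffix_cons_iff.1 hB with e | hB
    · simp only [List.cons.injEq, Prod.mk.injEq] at e
      obtain ⟨⟨rfl, rfl⟩, rfl⟩ := e
      refine ⟨(hm _ _ _ List.suffix_rfl).1, ?_⟩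
      intro s i p u hu
      rcases List.suffix_cons_iff.1 hu with e | hu
      · simp only [List.cons.injEq, Prod.mk.injEq] at e
        obtain ⟨⟨rfl, rfl, rfl⟩, rfl⟩ := e
        exact ⟨n, _, _, rfl, by omega, hF, rfl, List.suffix_rfl⟩
      · exact (hm _ _ _ List.suffix_rfl).2 s i p u hu
    · exact hm.suffix (List.suffix_cons _ _) _ _ _ hB
  | .pop1, (b, x :: w) :: rest =>
    simp only [_root_.step, Option.some.injEq] at hs
    subst hs
    intro q v B hB
    rcases List.suffix_cons_iff.1 hB with e | hB
    · simp only [List.cons.injEq, Prod.mk.injEq] at e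
      obtain ⟨⟨rfl, rfl⟩, rfl⟩ := e
      refine ⟨(hm _ _ _ List.suffix_rfl).1, ?_⟩
      intro s i p u hu
      exact (hm _ _ _ List.suffix_rfl).2 s i p u (hu.trans (List.suffix_cons _ _))
    · exact hm.suffix (List.suffix_cons _ _) _ _ _ hB
  | .collapse, (b, (s, i, p) :: w) :: rest =>
    simp only [_root_.step] at hs
    split_ifs at hs
    simp only [Option.some.injEq] at hs
    subst hs
    exact hm.suffix (List.drop_suffix _ _)

theorem good_run {S : Type} (ops : List (Op S)) (hv : Valid ops) :
    ∀ n, n ≤ ops.length → ∀ W, stkBefore ops n = some W → Good (stkBefore ops) n W ∧ W ≠ [] := by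
  intro n
  induction n with
  | zero =>
    intro _ W hW
    simp only [stkBefore, List.take_zero, runFrom, Option.some.injEq, initStk] at hW
    subst hW
    refine ⟨?_, by simp⟩
    intro q v B hB
    rcases List.suffix_cons_iff.1 hB with e | hB
    · simp only [List.cons.injEq, Prod.mk.injEq] at e
      obtain ⟨⟨rfl, rfl⟩, rfl⟩ := e
      refine ⟨Or.inl ⟨rfl, rfl⟩, ?_⟩
      intro s i p u hu
      simp at hu
    · simp at hB
  | succ n ih =>
    intro hn W hW
    obtain ⟨W0, h0⟩ := stkBefore_isSome ops hv n
    have hs := stkBefore_succ ops n (by omega)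
    rw [hW, h0, Option.bind_some] at hs
    refine ⟨(ih (by omega) W0 h0).1.step h0 hs.symm, ?_⟩
    rintro rfl
    revert hs
    generalize ops[n] = op
    intro hs
    match op, W0 with
    | .push2, [] => simp [_root_.step] at hs
    | .pop2, [] => simp [_root_.step] at hs
    | .pop1, [] => simp [_root_.step] at hs
    | .push1 _, [] => simp [_root_.step] at hs
    | .collapse, [] => simp [_root_.step] at hs
    | .pop2, [_] => simp [_root_.step] at hs
    | .pop1, (_, []) :: _ => simp [_root_.step] at hs
    | .collapse, (_, []) :: _ => simp [_root_.step] at hs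
    | .push2, (b, w) :: rest => simp [_root_.step] at hs
    | .pop2, _ :: t :: rest => simp [_root_.step] at hs
    | .push1 s, (b, w) :: rest => simp [_root_.step] at hs
    | .pop1, (b, x :: w) :: rest => simp [_root_.step] at hs
    | .collapse, (b, (s, i, p) :: w) :: rest =>
      simp only [_root_.step] at hs
      split_ifs at hs with hi
      simp only [Option.some.injEq] at hs
      have := congrArg List.length hs
      simp only [List.length_drop, List.length_nil] at this
      omega

/-- Top order-1 stack annotated `k`. -/
def Top2 {S : Type} (ops : List (Op S)) (n k : ℕ) : Prop :=
  ∃ v B, stkBefore ops n = some (((k : ℤ), v) :: B)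

/-- Top symbol annotated `k`. -/
def Top1 {S : Type} (ops : List (Op S)) (n k : ℕ) : Prop :=
  ∃ q s i u B, stkBefore ops n = some ((q, (s, i, (k : ℤ)) :: u) :: B)

/-- Top stacks. -/
theorem pop2_run {S : Type} (ops : List (Op S)) (hv : Valid ops) (n b : ℕ) (hn : n < ops.length)
    (ho : ops[n] = Op.pop2) (hb : Top2 ops n b) :
    b < n ∧ stkBefore ops (n + 1) = stkBefore ops b := by
  obtain ⟨v, B, hB⟩ := hb
  have hg := ((good_run ops hv n hn.le _ hB).1 _ _ _ List.suffix_rfl).1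
  rcases hg with ⟨_, h⟩ | ⟨m, e, hm, hF, hne⟩
  · omega
  · obtain rfl : b = m := by exact_mod_cast e
    refine ⟨hm, ?_⟩
    rw [stkBefore_succ ops n hn, hB, hF, ho]
    cases B with
    | nil => exact absurd rfl hne
    | cons t r => rfl

theorem collapse_run {S : Type} (ops : List (Op S)) (hv : Valid ops) (n c : ℕ)
    (hn : n < ops.length) (ho : ops[n] = Op.collapse) (hc : Top1 ops n c) :
    c < n ∧ ∃ b, b < c ∧ Top2 ops c b ∧ stkBefore ops (n + 1) = stkBefore ops b := by
  obtain ⟨q, s, i, u, B, hB⟩ := hc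
  obtain ⟨m, a, R, e, hm, hF, hi, hR⟩ :=
    ((good_run ops hv n hn.le _ hB).1 _ _ _ List.suffix_rfl).2 _ _ _ _ List.suffix_rfl
  obtain rfl : c = m := by exact_mod_cast e
  refine ⟨hm, ?_⟩
  obtain ⟨W', hW'⟩ := stkBefore_isSome ops hv (n + 1)
  have hs := stkBefore_succ ops n hn
  rw [hW', hB, ho, Option.bind_some] at hs
  simp only [step] at hs
  split_ifs at hs with hi1
  rw [← hi, drop_of_suffix (hR.trans (List.suffix_cons _ _))] at hs
  rcases ((good_run ops hv c (by omega) _ hF).1 _ _ _ List.suffix_rfl).1 with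
    ⟨h, _⟩ | ⟨b, rfl, hb, hFb, _⟩
  · subst h; simp at hi; omega
  · exact ⟨b, hb, ⟨_, _, hF⟩, by rw [hW', hFb, hs]⟩

theorem pop1_run {S : Type} (ops : List (Op S)) (hv : Valid ops) (n b k : ℕ)
    (hn : n < ops.length) (ho : ops[n] = Op.pop1) (hc : Top1 ops n b) :
    b < n ∧ (Top1 ops (n + 1) k ↔ Top1 ops b k) := by
  obtain ⟨q, s, i, u, B, hB⟩ := hc
  obtain ⟨m, a, R, e, hm, hF, hi, hR⟩ :=
    ((good_run ops hv n hn.le _ hB).1 _ _ _ List.suffix_rfl).2 _ _ _ _ List.suffix_rfl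
  obtain rfl : b = m := by exact_mod_cast e
  refine ⟨hm, ?_⟩
  have hs := stkBefore_succ ops n hn
  rw [hB, ho, Option.bind_some] at hs
  simp only [step] at hs
  unfold Top1
  rw [hs, hF]
  simp

theorem pop1_top2 {S : Type} (ops : List (Op S)) (hv : Valid ops) (n k : ℕ)
    (hn : n < ops.length) (ho : ops[n] = Op.pop1) :
    (∃ b, Top1 ops n b) ∧ (Top2 ops (n + 1) k ↔ Top2 ops n k) := by
  obtain ⟨W, hW⟩ := stkBefore_isSome ops hv n
  obtain ⟨W', hW'⟩ := stkBefore_isSome ops hv (n + 1)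
  have hs := stkBefore_succ ops n hn
  rw [hW', hW, ho, Option.bind_some] at hs
  match W with
  | [] => simp [step] at hs
  | (_, []) :: _ => simp [step] at hs
  | (q, (s, i, p) :: u) :: B =>
    simp only [step] at hs
    obtain ⟨m, a, R, e, hm, hF, hi, hR⟩ :=
      ((good_run ops hv n hn.le _ hW).1 _ _ _ List.suffix_rfl).2 _ _ _ _ List.suffix_rfl
    subst e
    refine ⟨⟨m, _, _, _, _, _, hW⟩, ?_⟩
    unfold Top2
    rw [hW', hW, hs]
    simp

theorem push1_run {S : Type} (ops : List (Op S)) (hv : Valid ops) (n k : ℕ) (s : S)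
    (hn : n < ops.length) (ho : ops[n] = Op.push1 s) :
    (Top1 ops (n + 1) k ↔ k = n) ∧ (Top2 ops (n + 1) k ↔ Top2 ops n k) := by
  obtain ⟨W, hW⟩ := stkBefore_isSome ops hv n
  have hne := (good_run ops hv n hn.le _ hW).2
  have hs := stkBefore_succ ops n hn
  rw [hW, ho, Option.bind_some] at hs
  match W with
  | [] => exact absurd rfl hne
  | (q, u) :: B =>
    simp only [step] at hs
    unfold Top1 Top2
    rw [hW, hs]
    simp [eq_comm]

theorem push2_run {S : Type} (ops : List (Op S)) (hv : Valid ops) (n k : ℕ)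
    (hn : n < ops.length) (ho : ops[n] = Op.push2) :
    (Top2 ops (n + 1) k ↔ k = n) ∧ (Top1 ops (n + 1) k ↔ Top1 ops n k) := by
  obtain ⟨W, hW⟩ := stkBefore_isSome ops hv n
  have hne := (good_run ops hv n hn.le _ hW).2
  have hs := stkBefore_succ ops n hn
  rw [hW, ho, Option.bind_some] at hs
  match W with
  | [] => exact absurd rfl hne
  | (q, u) :: B =>
    simp only [step] at hs
    unfold Top1 Top2
    rw [hW, hs]
    simp [eq_comm]

theorem pop2_top {S : Type} (ops : List (Op S)) (hv : Valid ops) (n : ℕ)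
    (hn : n < ops.length) (ho : ops[n] = Op.pop2) : ∃ b, Top2 ops n b := by
  obtain ⟨W, hW⟩ := stkBefore_isSome ops hv n
  obtain ⟨W', hW'⟩ := stkBefore_isSome ops hv (n + 1)
  have hs := stkBefore_succ ops n hn
  rw [hW', hW, ho, Option.bind_some] at hs
  match W with
  | [] => simp [step] at hs
  | [_] => simp [step] at hs
  | (q, v) :: t :: r =>
    rcases ((good_run ops hv n hn.le _ hW).1 _ _ _ List.suffix_rfl).1 with
      ⟨h, _⟩ | ⟨b, rfl, _⟩
    · simp at h
    · exact ⟨b, _, _, hW⟩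

theorem collapse_top {S : Type} (ops : List (Op S)) (hv : Valid ops) (n : ℕ)
    (hn : n < ops.length) (ho : ops[n] = Op.collapse) : ∃ b, Top1 ops n b := by
  obtain ⟨W, hW⟩ := stkBefore_isSome ops hv n
  obtain ⟨W', hW'⟩ := stkBefore_isSome ops hv (n + 1)
  have hs := stkBefore_succ ops n hn
  rw [hW', hW, ho, Option.bind_some] at hs
  match W with
  | [] => simp [step] at hs
  | (_, []) :: _ => simp [step] at hs
  | (q, (s, i, p) :: u) :: B =>
    obtain ⟨m, a, R, e, hm, hF, hi, hR⟩ :=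
      ((good_run ops hv n hn.le _ hW).1 _ _ _ List.suffix_rfl).2 _ _ _ _ List.suffix_rfl
    subst e
    exact ⟨m, _, _, _, _, _, hW⟩

theorem top_congr {S : Type} {ops : List (Op S)} {n b : ℕ}
    (h : stkBefore ops n = stkBefore ops b) (k : ℕ) :
    (Top1 ops n k ↔ Top1 ops b k) ∧ (Top2 ops n k ↔ Top2 ops b k) := by
  unfold Top1 Top2; rw [h]; exact ⟨Iff.rfl, Iff.rfl⟩

theorem top_lt {S : Type} (ops : List (Op S)) (hv : Valid ops) (n k : ℕ) (hn : n ≤ ops.length) :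
    (Top1 ops n k → k < n) ∧ (Top2 ops n k → k < n) := by
  constructor
  · rintro ⟨q, s, i, u, B, hB⟩
    obtain ⟨m, a, R, e, hm, -⟩ :=
      ((good_run ops hv n hn _ hB).1 _ _ _ List.suffix_rfl).2 _ _ _ _ List.suffix_rfl
    omega
  · rintro ⟨v, B, hB⟩
    rcases ((good_run ops hv n hn _ hB).1 _ _ _ List.suffix_rfl).1 with ⟨_, h⟩ | ⟨b, e, hb, _⟩
    · omega
    · omega

theorem seg_append {S : Type} (ops : List (Op S)) {a b c : ℕ} (h1 : a ≤ b) (h2 : b ≤ c) :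
    seg ops a b ++ seg ops b c = seg ops a c := by
  unfold seg
  rw [List.drop_take, List.drop_take, List.drop_take,
    show c - a = (b - a) + (c - b) by omega, List.take_add, List.drop_drop,
    show a + (b - a) = b by omega]

theorem seg_single {S : Type} (ops : List (Op S)) {n : ℕ} (h : n < ops.length) :
    seg ops n (n + 1) = [ops[n]] := by
  unfold seg
  rw [List.take_succ_eq_append_getElem h]
  rw [List.drop_append_of_le_length (by simp; omega), List.drop_eq_nil_of_le (by simp)]
  rfl

theorem seg_snoc {S : Type} (ops : List (Op S)) {a n : ℕ} (h1 : a ≤ n) (h : n < ops.length) :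
    seg ops a (n + 1) = seg ops a n ++ [ops[n]] := by
  rw [← seg_single ops h, seg_append ops h1 (by omega)]

theorem seg_split {S : Type} {ops : List (Op S)} {k n : ℕ} {v w : List (Op S)}
    (hk : k ≤ n) (hn : n ≤ ops.length) (h : seg ops k n = v ++ w) :
    ∃ b, k ≤ b ∧ b ≤ n ∧ seg ops k b = v ∧ seg ops b n = w := by
  have hl := congrArg List.length h
  simp [seg] at hl
  refine ⟨k + v.length, by omega, by omega, ?_⟩
  rw [← seg_append ops (b := k + v.length) (by omega) (by omega)] at h
  exact List.append_inj h (by simp [seg]; omega)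

theorem seg_snoc_split {S : Type} {ops : List (Op S)} {k n : ℕ} {v : List (Op S)} {o : Op S}
    (hk : k ≤ n) (hn : n ≤ ops.length) (h : seg ops k n = v ++ [o]) :
    ∃ b, ∃ hb : b < ops.length, k ≤ b ∧ n = b + 1 ∧ seg ops k b = v ∧ ops[b] = o := by
  obtain ⟨b, h1, h2, h3, h4⟩ := seg_split hk hn h
  have hl := congrArg List.length h4
  simp [seg] at hl
  obtain rfl : n = b + 1 := by omega
  refine ⟨b, by omega, h1, rfl, h3, ?_⟩
  rw [seg_single ops (by omega)] at h4
  simpa using h4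

theorem top_to_lang {S : Type} (ops : List (Op S)) (hv : Valid ops) (n : ℕ) :
    n ≤ ops.length → ∀ k, (Top1 ops n k → InL1 (seg ops k n)) ∧
      (Top2 ops n k → InL2 (seg ops k n)) := by
  induction n using Nat.strong_induction_on with
  | _ n ih =>
  intro hn k
  cases n with
  | zero => exact ⟨fun h => absurd ((top_lt ops hv 0 k hn).1 h) (by omega),
      fun h => absurd ((top_lt ops hv 0 k hn).2 h) (by omega)⟩
  | succ n =>
  have hn' : n < ops.length := hn
  have lt := fun m hm => top_lt ops hv m k hm
  have ihn := ih n (by omega) hn'.le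
  cases ho : ops[n] with
  | push1 s =>
    obtain ⟨h1, h2⟩ := push1_run ops hv n k s hn' ho
    rw [h1, h2]
    constructor
    · rintro rfl
      rw [seg_single ops hn', ho]; exact InL1.base s
    · intro h
      rw [seg_snoc ops ((lt n hn'.le).2 h).le hn', ho]
      exact InL2.push1 _ _ ((ihn k).2 h)
  | push2 =>
    obtain ⟨h1, h2⟩ := push2_run ops hv n k hn' ho
    rw [h1, h2]
    constructor
    · intro h
      rw [seg_snoc ops ((lt n hn'.le).1 h).le hn', ho]
      exact InL1.push2 _ ((ihn k).1 h)
    · rintro rfl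
      rw [seg_single ops hn', ho]; exact InL2.base
  | pop1 =>
    obtain ⟨⟨b, hb⟩, h2⟩ := pop1_top2 ops hv n k hn' ho
    obtain ⟨hbn, h1⟩ := pop1_run ops hv n b k hn' ho hb
    rw [h1, h2]
    constructor
    · intro h
      have hkb := (lt b (by omega)).1 h
      rw [seg_snoc ops (by omega) hn', ho, ← seg_append ops hkb.le hbn.le]
      exact InL1.pop1 _ _ ((ih b (by omega) (by omega) k).1 h) ((ihn b).1 hb)
    · intro h
      rw [seg_snoc ops ((lt n hn'.le).2 h).le hn', ho]
      exact InL2.pop1 _ ((ihn k).2 h)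
  | pop2 =>
    obtain ⟨b, hb⟩ := pop2_top ops hv n hn' ho
    obtain ⟨hbn, h⟩ := pop2_run ops hv n b hn' ho hb
    obtain ⟨h1, h2⟩ := top_congr h k
    rw [h1, h2]
    constructor
    · intro h
      have hkb := (lt b (by omega)).1 h
      rw [seg_snoc ops (by omega) hn', ho, ← seg_append ops hkb.le hbn.le]
      exact InL1.pop2 _ _ ((ih b (by omega) (by omega) k).1 h) ((ihn b).2 hb)
    · intro h
      have hkb := (lt b (by omega)).2 h
      rw [seg_snoc ops (by omega) hn', ho, ← seg_append ops hkb.le hbn.le]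
      exact InL2.pop2 _ _ ((ih b (by omega) (by omega) k).2 h) ((ihn b).2 hb)
  | collapse =>
    obtain ⟨c, hc⟩ := collapse_top ops hv n hn' ho
    obtain ⟨hcn, b, hbc, hb, h⟩ := collapse_run ops hv n c hn' ho hc
    obtain ⟨h1, h2⟩ := top_congr h k
    rw [h1, h2]
    have hw := (ih c (by omega) (by omega) b).2 hb
    have hx := (ihn c).1 hc
    constructor
    · intro h
      have hkb := (lt b (by omega)).1 h
      rw [seg_snoc ops (by omega) hn', ho, ← seg_append ops (show k ≤ c by omega) hcn.le,
        ← seg_append ops hkb.le hbc.le]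
      exact InL1.collapse _ _ _ ((ih b (by omega) (by omega) k).1 h) hw hx
    · intro h
      have hkb := (lt b (by omega)).2 h
      rw [seg_snoc ops (by omega) hn', ho, ← seg_append ops (show k ≤ c by omega) hcn.le,
        ← seg_append ops hkb.le hbc.le]
      exact InL2.collapse _ _ _ ((ih b (by omega) (by omega) k).2 h) hw hx

theorem Top2.unique {S : Type} {ops : List (Op S)} {n a b : ℕ}
    (h1 : Top2 ops n a) (h2 : Top2 ops n b) : a = b := by
  obtain ⟨v, B, h1⟩ := h1
  obtain ⟨v', B', h2⟩ := h2
  rw [h1] at h2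
  simp at h2
  exact h2.1.1

mutual
theorem lang1_to_top {S : Type} {ops : List (Op S)} (hv : Valid ops) {w : List (Op S)}
    (hw : InL1 w) (k n : ℕ) (hk : k ≤ n) (hn : n ≤ ops.length) (h : seg ops k n = w) :
    Top1 ops n k := by
  cases hw with
  | base s =>
    obtain ⟨b, hb, hkb, rfl, h0, ho⟩ := seg_snoc_split (v := []) hk hn h
    have hl := congrArg List.length h0
    simp [seg] at hl
    exact (push1_run ops hv b k s hb ho).1.2 (by omega)
  | push2 w hw =>
    obtain ⟨b, hb, hkb, rfl, h0, ho⟩ := seg_snoc_split hk hn h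
    exact (push2_run ops hv b k hb ho).2.2 (lang1_to_top hv hw k b hkb hb.le h0)
  | pop1 v w hv' hw =>
    obtain ⟨b, hb, hkb, rfl, h0, ho⟩ := seg_snoc_split hk hn h
    obtain ⟨c, hkc, hcb, h1, h2⟩ := seg_split hkb hb.le h0
    exact (pop1_run ops hv b c k hb ho (lang1_to_top hv hw c b hcb hb.le h2)).2.2
      (lang1_to_top hv hv' k c hkc (by omega) h1)
  | pop2 v w hv' hw =>
    obtain ⟨b, hb, hkb, rfl, h0, ho⟩ := seg_snoc_split hk hn h
    obtain ⟨c, hkc, hcb, h1, h2⟩ := seg_split hkb hb.le h0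
    have e := (pop2_run ops hv b c hb ho (lang2_to_top hv hw c b hcb hb.le h2)).2
    exact (top_congr e k).1.2 (lang1_to_top hv hv' k c hkc (by omega) h1)
  | collapse v w x hv' hw hx =>
    obtain ⟨b, hb, hkb, rfl, h0, ho⟩ := seg_snoc_split hk hn h
    obtain ⟨c, hkc, hcb, h1, h2⟩ := seg_split hkb hb.le h0
    obtain ⟨d, hkd, hdc, h3, h4⟩ := seg_split hkc (by omega) h1
    obtain ⟨_, d', _, hd', e⟩ :=
      collapse_run ops hv b c hb ho (lang1_to_top hv hx c b hcb hb.le h2)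
    obtain rfl := hd'.unique (lang2_to_top hv hw d c hdc (by omega) h4)
    exact (top_congr e k).1.2 (lang1_to_top hv hv' k _ hkd (by omega) h3)

theorem lang2_to_top {S : Type} {ops : List (Op S)} (hv : Valid ops) {w : List (Op S)}
    (hw : InL2 w) (k n : ℕ) (hk : k ≤ n) (hn : n ≤ ops.length) (h : seg ops k n = w) :
    Top2 ops n k := by
  cases hw with
  | base =>
    obtain ⟨b, hb, hkb, rfl, h0, ho⟩ := seg_snoc_split (v := []) hk hn h
    have hl := congrArg List.length h0
    simp [seg] at hl
    exact (push2_run ops hv b k hb ho).1.2 (by omega)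
  | push1 s w hw =>
    obtain ⟨b, hb, hkb, rfl, h0, ho⟩ := seg_snoc_split hk hn h
    exact (push1_run ops hv b k s hb ho).2.2 (lang2_to_top hv hw k b hkb hb.le h0)
  | pop1 w hw =>
    obtain ⟨b, hb, hkb, rfl, h0, ho⟩ := seg_snoc_split hk hn h
    exact (pop1_top2 ops hv b k hb ho).2.2 (lang2_to_top hv hw k b hkb hb.le h0)
  | pop2 v w hv' hw =>
    obtain ⟨b, hb, hkb, rfl, h0, ho⟩ := seg_snoc_split hk hn h
    obtain ⟨c, hkc, hcb, h1, h2⟩ := seg_split hkb hb.le h0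
    have e := (pop2_run ops hv b c hb ho (lang2_to_top hv hw c b hcb hb.le h2)).2
    exact (top_congr e k).2.2 (lang2_to_top hv hv' k c hkc (by omega) h1)
  | collapse v w x hv' hw hx =>
    obtain ⟨b, hb, hkb, rfl, h0, ho⟩ := seg_snoc_split hk hn h
    obtain ⟨c, hkc, hcb, h1, h2⟩ := seg_split hkb hb.le h0
    obtain ⟨d, hkd, hdc, h3, h4⟩ := seg_split hkc (by omega) h1
    obtain ⟨_, d', _, hd', e⟩ :=
      collapse_run ops hv b c hb ho (lang1_to_top hv hx c b hcb hb.le h2)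
    obtain rfl := hd'.unique (lang2_to_top hv hw d c hdc (by omega) h4)
    exact (top_congr e k).2.2 (lang2_to_top hv hv' k _ hkd (by omega) h3)
end

/-- For a valid sequence `op_0 ⋯ op_n` of order-2 stack operations and all
`0 ≤ j ≤ n`: `Push2(j) = -1` iff no factor `op_k ⋯ op_j` (`0 ≤ k ≤ j`) belongs to `L2`. -/
theorem Push2_eq_neg_one_iff {S : Type} (ops : List (Op S)) (hv : Valid ops)
    (j : ℕ) (hj : j < ops.length) :
    Push2At ops (j : ℤ) = -1 ↔ ∀ k : ℕ, k ≤ j → ¬ InL2 (factor ops k j) := by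
  have hf : ∀ k, factor ops k j = seg ops k (j + 1) := by
    intro k; unfold factor seg; rw [List.drop_take]
  have hst : stkAt ops (j : ℤ) = stkBefore ops (j + 1) := by
    unfold stkAt stkBefore; rfl
  obtain ⟨W, hW⟩ := stkBefore_isSome ops hv (j + 1)
  obtain ⟨hg, hne⟩ := good_run ops hv (j + 1) hj W hW
  match W with
  | [] => exact absurd rfl hne
  | (q, v) :: B =>
    have hP : Push2At ops (j : ℤ) = q := by
      unfold Push2At; rw [hst, hW]
    rw [hP]
    constructor
    · intro hq k hk hL
      rw [hf] at hL
      obtain ⟨v', B', h⟩ := lang2_to_top hv hL k (j + 1) (by omega) hj rfl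
      rw [hW] at h
      simp at h
      omega
    · intro hL
      rcases (hg _ _ _ List.suffix_rfl).1 with ⟨_, h⟩ | ⟨m, rfl, hm, _⟩
      · exact h
      · exact absurd ((top_to_lang ops hv (j + 1) hj m).2 ⟨_, _, hW⟩)
          (by rw [← hf]; exact hL m (by omega))
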